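/- arXiv:1710.06821 — 2 statements merged into one kernel-verified Lean document; each statement's English description precedes it below -/
import Mathlib

section
/- Let a ∈ ℤ and let f(x) = (x+a)^2 - a be irreducible over ℚ. Then f^n(x) is irreducible over ℚ for all n ≥ 1 if and only if a ≠ -4u^4 for every u ∈ ℤ. -/
open Polynomial

/-- The `n`-th iterate of a polynomial under composition. -/
noncomputable def iter {R : Type*} [CommRing R] (f : Polynomial R) : ℕ → Polynomial R
  | 0 => Polynomial.X
  | n + 1 => f.comp (iter f n)

lemma quad_form {K : Type*} [Field K] {E : Type*} [Field E] [Algebra K E] (x : E) (c : K)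
    (hx : minpoly K x = X ^ 2 - C c) (b : IntermediateField.adjoin K {x}) :
    ∃ p q : K, (b : E) = algebraMap K E p + algebraMap K E q * x := by
  have hi : IsIntegral K x := by
    by_contra h
    have h0 := minpoly.eq_zero h
    rw [hx] at h0
    exact X_pow_sub_C_ne_zero (by norm_num) c h0
  obtain ⟨g, hg, hb⟩ := (IntermediateField.adjoin.powerBasis hi).exists_eq_aeval b
  rw [IntermediateField.adjoin.powerBasis_dim, hx, natDegree_X_pow_sub_C] at hg
  rw [IntermediateField.adjoin.powerBasis_gen] at hb
  refine ⟨g.coeff 0, g.coeff 1, ?_⟩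
  have h1 : g = C (g.coeff 1) * X + C (g.coeff 0) :=
    eq_X_add_C_of_natDegree_le_one (by omega)
  rw [h1] at hb
  rw [hb]
  simp
  ring

lemma quad_key {K : Type*} [Field K] (h2 : (2 : K) ≠ 0) {E : Type*} [Field E] [Algebra K E]
    (x : E) (c : K) (hx : minpoly K x = X ^ 2 - C c) (e : K) (he : e ^ 2 = 1)
    (b : IntermediateField.adjoin K {x})
    (hb : (b : E) ^ 2 = algebraMap K E e * x) : ∃ u : K, c = -4 * u ^ 4 := by
  obtain ⟨p, q, hpq⟩ := quad_form x c hx b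
  have hxx : x ^ 2 = algebraMap K E c := by
    have := minpoly.aeval K x
    rw [hx] at this
    simpa [sub_eq_zero] using this
  have hlin : algebraMap K E (p ^ 2 + c * q ^ 2) + algebraMap K E (2 * p * q - e) * x = 0 := by
    rw [hpq] at hb
    simp only [map_add, map_sub, map_mul, map_pow, map_ofNat]
    rw [← hxx]
    linear_combination hb
  have hz : 2 * p * q - e = 0 ∧ p ^ 2 + c * q ^ 2 = 0 := by
    have hdeg : C (2 * p * q - e) * X + C (p ^ 2 + c * q ^ 2) = (0 : K[X]) := by
      by_contra hne
      have h := minpoly.degree_le_of_ne_zero K x hne (by simpa [add_comm] using hlin)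
      rw [hx, degree_X_pow_sub_C (by norm_num)] at h
      have h' := h.trans degree_linear_le
      exact absurd h' (by decide)
    generalize 2 * p * q - e = s at hdeg ⊢
    generalize p ^ 2 + c * q ^ 2 = t at hdeg ⊢
    constructor
    · simpa using congrArg (fun g => g.coeff 1) hdeg
    · simpa using congrArg (fun g => g.coeff 0) hdeg
  obtain ⟨h3, h4⟩ := hz
  refine ⟨p, ?_⟩
  linear_combination (4 * p ^ 2) * h4 + (-c * (2 * p * q + e)) * h3 - c * he

lemma two_pow_irr.{u} (n : ℕ) : ∀ {K : Type u} [Field K], (2 : K) ≠ 0 → ∀ c : K,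
    (∀ b : K, b ^ 2 ≠ c) → (∀ u : K, c ≠ -4 * u ^ 4) → Irreducible (X ^ (2 ^ n) - C c) := by
  induction n with
  | zero => intro K _ _ c _ _; simpa using irreducible_X_sub_C c
  | succ n ih =>
    intro K _ h2 c hsq h4
    rw [pow_succ]
    apply X_pow_mul_sub_C_irreducible (X_pow_sub_C_irreducible_of_prime Nat.prime_two hsq)
    intro E _ _ x hx
    apply ih
    · intro h
      apply h2
      apply (algebraMap K (IntermediateField.adjoin K {x})).injective
      rw [map_ofNat, map_zero]
      exact h
    · intro b hb
      obtain ⟨u, hu⟩ := quad_key h2 x c hx 1 (by ring) b (by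
        have := congrArg (fun z : IntermediateField.adjoin K {x} => (z : E)) hb
        simpa using this)
      exact h4 u hu
    · intro v hv
      have hv' : x = -4 * (v : E) ^ 4 := by
        have := congrArg (algebraMap (IntermediateField.adjoin K {x}) E) hv
        rw [map_mul, map_neg, map_ofNat, map_pow] at this
        exact this
      obtain ⟨u, hu⟩ := quad_key h2 x c hx (-1) (by ring) (2 * v ^ 2) (by
        have h2v : ((2 * v ^ 2 : IntermediateField.adjoin K {x}) : E) = 2 * (v : E) ^ 2 := by
          change algebraMap (IntermediateField.adjoin K {x}) E (2 * v ^ 2) = _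
          rw [map_mul, map_ofNat, map_pow]
          rfl
        rw [h2v]
        simp only [map_neg, map_one]
        linear_combination hv')
      exact h4 u hu

lemma iter_formula (a : ℚ) (n : ℕ) :
    iter ((X + C a) ^ 2 - C a) n = (X + C a) ^ (2 ^ n) - C a := by
  induction n with
  | zero => simp [iter]
  | succ n ih =>
    rw [iter, ih]
    simp [pow_succ, pow_mul]

lemma irr_shift (a : ℚ) (m : ℕ) :
    Irreducible ((X + C a) ^ m - C a) ↔ Irreducible (X ^ m - C a) := by
  rw [← MulEquiv.irreducible_iff (algEquivAevalXAddC a) (x := X ^ m - C a)]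
  simp [algEquivAevalXAddC]

lemma rat_int (r : ℚ) (k : ℤ) (h : r ^ 2 = k) : ∃ m : ℤ, r = m := by
  have hi : IsIntegral ℤ r := by
    refine IsIntegral.of_pow (n := 2) (by norm_num) ?_
    rw [h]
    exact isIntegral_algebraMap (R := ℤ) (x := k)
  obtain ⟨m, hm⟩ := IsIntegrallyClosed.isIntegral_iff.mp hi
  exact ⟨m, by simpa using hm.symm⟩

lemma rat_four (a : ℤ) (u : ℚ) (h : (a : ℚ) = -4 * u ^ 4) : ∃ v : ℤ, a = -4 * v ^ 4 := by
  obtain ⟨r, hr⟩ := rat_int (2 * u ^ 2) (-a) (by push_cast; linear_combination h)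
  obtain ⟨m, hm⟩ := rat_int (2 * u) (2 * r) (by push_cast; linear_combination 2 * hr)
  have h4 : 4 * a = - m ^ 4 := by
    have : (4 * a : ℚ) = - m ^ 4 := by rw [← hm]; linear_combination 4 * h
    exact_mod_cast this
  have hev : Even (m ^ 4) := ⟨-(2 * a), by linarith⟩
  rw [Int.even_pow] at hev
  obtain ⟨v, hv⟩ := hev.1
  refine ⟨v, ?_⟩
  subst hv
  linarith [show (v + v) ^ 4 = 16 * v ^ 4 by ring]

/-- `f(x) = (x+a)^2 - a` irreducible over ℚ is stable iff `a ≠ -4u^4` for all `u ∈ ℤ`. -/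
theorem stmt2 (a : ℤ) (f : Polynomial ℚ)
    (hf : f = (X + C (a : ℚ)) ^ 2 - C (a : ℚ)) (hirr : Irreducible f) :
    (∀ n : ℕ, 1 ≤ n → Irreducible (iter f n)) ↔ ∀ u : ℤ, a ≠ -4 * u ^ 4 := by
  subst hf
  have h1 : Irreducible (X ^ 2 - C (a : ℚ)) := (irr_shift _ 2).mp hirr
  constructor
  · intro h u hu
    have h2 := h 2 (by norm_num)
    rw [iter_formula, irr_shift] at h2
    have hfac : (X ^ (2 ^ 2) - C (a : ℚ)) =
        (X ^ 2 + C (2 * u : ℚ) * X + C (2 * u ^ 2 : ℚ)) *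
        (X ^ 2 + C (-2 * u : ℚ) * X + C (2 * u ^ 2 : ℚ)) := by
      rw [hu]
      push_cast
      simp only [map_mul, map_neg, map_pow, map_ofNat]
      ring
    have hnu : ∀ p q : ℚ, ¬ IsUnit (X ^ 2 + C p * X + C q) := by
      intro p q hun
      have h3 : (X ^ 2 + C p * X + C q).natDegree = 2 := by compute_degree!
      rw [natDegree_eq_zero_of_isUnit hun] at h3
      norm_num at h3
    rcases h2.isUnit_or_isUnit hfac with h3 | h3
    · exact hnu _ _ h3
    · exact hnu _ _ h3
  · intro h n _
    rw [iter_formula, irr_shift]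
    apply two_pow_irr n (by norm_num)
    · exact pow_ne_of_irreducible_X_pow_sub_C h1 dvd_rfl (by norm_num)
    · intro u hu
      obtain ⟨v, hv⟩ := rat_four a u hu
      exact h v hv
end

section
/- The only positive integer solutions of the Diophantine equation 2p^4 - 1 = t^2 (in positive integers p, t) have p = 1 or p = 13. -/
namespace Lj
open Finset Real

noncomputable def U (n : ℕ) : ℝ := ∏ j ∈ range n, ((j : ℝ) + 1 + 1 / 4)
noncomputable def V (n : ℕ) : ℝ := ∏ j ∈ range n, ((j : ℝ) + 1 - 1 / 4)
noncomputable def ec (k : ℕ) : ℝ := 1 / (k.factorial * V k)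
noncomputable def fc (m : ℕ) : ℝ := 1 / (m.factorial * U m)

/-- The angle attached to the pair `(k, m)`. -/
noncomputable def ang (k m : ℕ) (x : ℝ) : ℝ := ((m : ℝ) - k + 1 / 4) * x

noncomputable def R (r : ℕ) (x : ℝ) : ℝ :=
  ∑ p ∈ antidiagonal r, ec p.1 * fc p.2 * sin (ang p.1 p.2 x)
noncomputable def A (r : ℕ) (x : ℝ) : ℝ :=
  ∑ p ∈ antidiagonal r, ec p.1 * fc p.2 * cos (ang p.1 p.2 x)

lemma U_pos (n : ℕ) : 0 < U n := prod_pos fun j _ => by positivity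
lemma V_pos (n : ℕ) : 0 < V n := prod_pos fun j _ => by
  have : (0 : ℝ) ≤ j := by positivity
  linarith
lemma ec_pos (n : ℕ) : 0 < ec n := by
  have := V_pos n
  unfold ec; positivity
lemma fc_pos (n : ℕ) : 0 < fc n := by
  have := U_pos n
  unfold fc; positivity

lemma ec_succ (k : ℕ) : ec (k + 1) * (((k + 1 : ℕ) : ℝ) * (((k + 1 : ℕ) : ℝ) - 1 / 4)) = ec k := by
  have h1 := V_pos k
  have h2 : (0 : ℝ) < (k : ℝ) + 1 - 1 / 4 := by
    have : (0 : ℝ) ≤ k := by positivity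
    linarith
  have h3 : V (k + 1) = V k * ((k : ℝ) + 1 - 1 / 4) := prod_range_succ _ _
  unfold ec
  rw [h3, Nat.factorial_succ]
  push_cast
  have : (0 : ℝ) < k.factorial := by positivity
  generalize ((k : ℝ) + 1 - 1 / 4) = y at *
  field_simp

lemma fc_succ (k : ℕ) : fc (k + 1) * (((k + 1 : ℕ) : ℝ) * (((k + 1 : ℕ) : ℝ) + 1 / 4)) = fc k := by
  have h1 := U_pos k
  have h2 : (0 : ℝ) < (k : ℝ) + 1 + 1 / 4 := by positivity
  have h3 : U (k + 1) = U k * ((k : ℝ) + 1 + 1 / 4) := prod_range_succ _ _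
  unfold fc
  rw [h3, Nat.factorial_succ]
  push_cast
  have : (0 : ℝ) < k.factorial := by positivity
  generalize ((k : ℝ) + 1 + 1 / 4) = y at *
  field_simp

lemma shift_m (r : ℕ) (w : ℕ → ℕ → ℝ) :
    ∑ p ∈ antidiagonal (r + 1), ec p.1 * fc p.2 * (((p.2 : ℝ) * (p.2 + 1 / 4)) * w p.1 p.2)
      = ∑ p ∈ antidiagonal r, ec p.1 * fc p.2 * w p.1 (p.2 + 1) := by
  rw [Finset.Nat.sum_antidiagonal_succ']
  simp only [Nat.cast_zero, zero_mul, mul_zero, zero_add]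
  refine sum_congr rfl fun p _ => ?_
  rw [← fc_succ p.2]; ring

lemma shift_k (r : ℕ) (w : ℕ → ℕ → ℝ) :
    ∑ p ∈ antidiagonal (r + 1), ec p.1 * fc p.2 * (((p.1 : ℝ) * (p.1 - 1 / 4)) * w p.1 p.2)
      = ∑ p ∈ antidiagonal r, ec p.1 * fc p.2 * w (p.1 + 1) p.2 := by
  rw [Finset.Nat.sum_antidiagonal_succ]
  simp only [Nat.cast_zero, zero_mul, mul_zero, zero_add]
  refine sum_congr rfl fun p _ => ?_
  rw [← ec_succ p.1]; ring

lemma ang_m (k m : ℕ) (x : ℝ) : ang k (m + 1) x = ang k m x + x := by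
  unfold ang; push_cast; ring
lemma ang_k (k m : ℕ) (x : ℝ) : ang (k + 1) m x = ang k m x - x := by
  unfold ang; push_cast; ring

lemma R_deriv (r : ℕ) (x : ℝ) :
    HasDerivAt (R (r + 1)) (-(2 / ((r : ℝ) + 1)) * sin x * R r x) x := by
  have h1 : HasDerivAt (R (r + 1)) (∑ p ∈ antidiagonal (r + 1),
      ec p.1 * fc p.2 * (cos (ang p.1 p.2 x) * ((p.2 : ℝ) - p.1 + 1 / 4))) x := by
    unfold R
    refine HasDerivAt.fun_sum fun p _ => ?_
    refine HasDerivAt.const_mul _ ?_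
    have : HasDerivAt (fun y => ang p.1 p.2 y) ((p.2 : ℝ) - p.1 + 1 / 4) x := by
      unfold ang
      simpa using (hasDerivAt_id x).const_mul ((p.2 : ℝ) - p.1 + 1 / 4)
    exact this.sin
  convert h1 using 1
  have hr : (0 : ℝ) < (r : ℝ) + 1 := by positivity
  have key : ((r : ℝ) + 1) * (∑ p ∈ antidiagonal (r + 1),
      ec p.1 * fc p.2 * (cos (ang p.1 p.2 x) * ((p.2 : ℝ) - p.1 + 1 / 4)))
      = - 2 * sin x * R r x := by
    have : ((r : ℝ) + 1) * (∑ p ∈ antidiagonal (r + 1),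
      ec p.1 * fc p.2 * (cos (ang p.1 p.2 x) * ((p.2 : ℝ) - p.1 + 1 / 4)))
      = ∑ p ∈ antidiagonal (r + 1), ec p.1 * fc p.2 * (((p.2 : ℝ) * (p.2 + 1 / 4)) * cos (ang p.1 p.2 x))
      - ∑ p ∈ antidiagonal (r + 1), ec p.1 * fc p.2 * (((p.1 : ℝ) * (p.1 - 1 / 4)) * cos (ang p.1 p.2 x)) := by
      rw [mul_sum, ← sum_sub_distrib]
      refine sum_congr rfl fun p hp => ?_
      have hp' : (r : ℝ) + 1 = p.1 + p.2 := by
        have := mem_antidiagonal.mp hp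
        exact_mod_cast this.symm
      rw [hp']; ring
    rw [this, shift_m r (fun k m => cos (ang k m x)), shift_k r (fun k m => cos (ang k m x)),
      ← sum_sub_distrib, R, mul_sum]
    refine sum_congr rfl fun p hp => ?_
    rw [ang_m, ang_k, cos_add, cos_sub]; ring
  rw [← mul_right_inj' hr.ne', key]
  field_simp

lemma A_rec (r : ℕ) (x : ℝ) :
    ((r : ℝ) + 1) * (r + 2) * (((r : ℝ) + 2) ^ 2 - 1 / 16) * A (r + 2) x
      = ((r : ℝ) + 1) * (2 * r + 3) * (2 * cos x) * A (r + 1) x + 4 * sin x ^ 2 * A r x := by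
  have e1 := shift_m (r + 1) (fun k m => cos (ang k m x))
  have e2 := shift_k (r + 1) (fun k m => cos (ang k m x))
  have e3 := (shift_m (r + 1) (fun k m => ((m : ℝ) - 1) * (m - 1 + 1 / 4) * cos (ang k m x))).trans
    ((sum_congr rfl fun p _ => by push_cast; ring).trans (shift_m r (fun k m => cos (ang k (m + 1) x))))
  have e4 := (shift_k (r + 1) (fun k m => ((k : ℝ) - 1) * (k - 1 - 1 / 4) * cos (ang k m x))).trans
    ((sum_congr rfl fun p _ => by push_cast; ring).trans (shift_k r (fun k m => cos (ang (k + 1) m x))))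
  have e5 := (shift_m (r + 1) (fun k m => ((k : ℝ) * (k - 1 / 4)) * cos (ang k m x))).trans
    (shift_k r (fun k m => cos (ang k (m + 1) x)))
  have L : ((r : ℝ) + 1) * (r + 2) * (((r : ℝ) + 2) ^ 2 - 1 / 16) * A (r + 2) x =
      ((r : ℝ) + 1) * (2 * r + 3) * (∑ p ∈ antidiagonal (r + 1 + 1),
        ec p.1 * fc p.2 * (((p.2 : ℝ) * (p.2 + 1 / 4)) * cos (ang p.1 p.2 x)))
      + ((r : ℝ) + 1) * (2 * r + 3) * (∑ p ∈ antidiagonal (r + 1 + 1),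
        ec p.1 * fc p.2 * (((p.1 : ℝ) * (p.1 - 1 / 4)) * cos (ang p.1 p.2 x)))
      - (∑ p ∈ antidiagonal (r + 1 + 1), ec p.1 * fc p.2 * (((p.2 : ℝ) * (p.2 + 1 / 4)) *
          (((p.2 : ℝ) - 1) * (p.2 - 1 + 1 / 4) * cos (ang p.1 p.2 x))))
      - (∑ p ∈ antidiagonal (r + 1 + 1), ec p.1 * fc p.2 * (((p.1 : ℝ) * (p.1 - 1 / 4)) *
          (((p.1 : ℝ) - 1) * (p.1 - 1 - 1 / 4) * cos (ang p.1 p.2 x))))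
      + 2 * (∑ p ∈ antidiagonal (r + 1 + 1), ec p.1 * fc p.2 * (((p.2 : ℝ) * (p.2 + 1 / 4)) *
          (((p.1 : ℝ) * (p.1 - 1 / 4)) * cos (ang p.1 p.2 x)))) := by
    unfold A
    simp only [mul_sum, ← sum_sub_distrib, ← sum_add_distrib]
    refine sum_congr rfl fun p hp => ?_
    have hp' : (r : ℝ) = p.1 + p.2 - 2 := by
      have := mem_antidiagonal.mp hp
      have h2 : ((p.1 + p.2 : ℕ) : ℝ) = ((r + 2 : ℕ) : ℝ) := by rw [this]
      push_cast at h2; linarith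
    rw [hp']; ring
  rw [L, e1, e2, e3, e4, e5]
  unfold A
  simp only [mul_sum, ← sum_add_distrib]
  rw [← sub_eq_zero]
  have h1 : ∀ p ∈ antidiagonal (r + 1), ((r : ℝ) + 1) * (2 * r + 3) * (ec p.1 * fc p.2 * cos (ang p.1 (p.2 + 1) x))
     + ((r : ℝ) + 1) * (2 * r + 3) * (ec p.1 * fc p.2 * cos (ang (p.1 + 1) p.2 x))
     = ((r : ℝ) + 1) * (2 * r + 3) * (2 * cos x) * (ec p.1 * fc p.2 * cos (ang p.1 p.2 x)) := by
    intro p _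
    rw [ang_m, ang_k, cos_add, cos_sub]; ring
  have h2 : ∀ p ∈ antidiagonal r, 4 * sin x ^ 2 * (ec p.1 * fc p.2 * cos (ang p.1 p.2 x))
     = 2 * (ec p.1 * fc p.2 * cos (ang (p.1 + 1) (p.2 + 1) x))
      - (ec p.1 * fc p.2 * cos (ang p.1 (p.2 + 1 + 1) x))
      - (ec p.1 * fc p.2 * cos (ang (p.1 + 1 + 1) p.2 x)) := by
    intro p _
    simp only [ang_m, ang_k]
    generalize ang p.1 p.2 x = y
    have : cos (y + x + x) + cos (y - x - x) = 2 * cos y - 4 * sin x ^ 2 * cos y := by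
      simp only [cos_add, cos_sub, sin_add, sin_sub]
      linear_combination (2 * cos y) * (sin_sq_add_cos_sq x)
    rw [show y - x + x = y by ring]
    linear_combination (ec p.1 * fc p.2) * this
  rw [sum_congr rfl h1, sum_congr rfl h2]
  simp only [sum_sub_distrib]
  ring

noncomputable def W (r : ℕ) : ℝ := U r * V r

lemma W_pos (r : ℕ) : 0 < W r := mul_pos (U_pos r) (V_pos r)
lemma W_succ (r : ℕ) : W (r + 1) = W r * (((r : ℝ) + 1) ^ 2 - 1 / 16) := by
  unfold W U V
  rw [prod_range_succ, prod_range_succ]; ring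

lemma A_zero (x : ℝ) : A 0 x = cos (x / 4) := by
  simp [A, ec, fc, U, V, ang]; ring_nf
lemma R_zero (x : ℝ) : R 0 x = sin (x / 4) := by
  simp [R, ec, fc, U, V, ang]; ring_nf
lemma A_one (x : ℝ) : A 1 x = 4 / 5 * cos (5 / 4 * x) + 4 / 3 * cos (3 / 4 * x) := by
  have : (Finset.HasAntidiagonal.antidiagonal 1 : Finset (ℕ × ℕ)) = {(0, 1), (1, 0)} := by decide
  unfold A
  rw [this, sum_pair (by decide)]
  simp [ec, fc, U, V, ang]
  rw [show ((-1 + 4⁻¹) * x : ℝ) = -(3 / 4 * x) by ring, cos_neg]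
  norm_num

lemma A_pos (x : ℝ) (h0 : 0 ≤ x) (h1 : x ≤ 1) (r : ℕ) : 0 < A r x ∧ 0 < A (r + 1) x := by
  have hpi := Real.pi_gt_three
  have hc : ∀ y : ℝ, 0 ≤ y → y ≤ 5 / 4 → 0 < cos y := fun y a b =>
    cos_pos_of_mem_Ioo ⟨by linarith, by linarith⟩
  induction r with
  | zero =>
    refine ⟨?_, ?_⟩
    · rw [A_zero]; exact hc _ (by linarith) (by linarith)
    · rw [A_one]
      have := hc (5 / 4 * x) (by linarith) (by linarith)
      have := hc (3 / 4 * x) (by linarith) (by linarith)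
      positivity
  | succ r ih =>
    refine ⟨ih.2, ?_⟩
    have h := A_rec r x
    have hcx := hc x h0 (by linarith)
    have ha := ih.1
    have hb := ih.2
    have hr : (0 : ℝ) ≤ r := by positivity
    have hpos : 0 < ((r : ℝ) + 1) * (2 * r + 3) * (2 * cos x) * A (r + 1) x + 4 * sin x ^ 2 * A r x := by
      positivity
    rw [← h] at hpos
    have h4 : 0 < ((r : ℝ) + 1) * (r + 2) * (((r : ℝ) + 2) ^ 2 - 1 / 16) := by
      have : 0 < (((r : ℝ) + 2) ^ 2 - 1 / 16) := by nlinarith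
      positivity
    exact pos_of_mul_pos_right hpos h4.le

lemma WA_zero_le (r : ℕ) : W r * A r 0 ≤ 4 ^ r ∧ W (r + 1) * A (r + 1) 0 ≤ 4 ^ (r + 1) := by
  induction r with
  | zero =>
    rw [W_succ, A_zero, A_one]
    simp [W, U, V]; norm_num
  | succ r ih =>
    refine ⟨ih.2, ?_⟩
    have h := A_rec r 0
    have h3 := ih.2
    rw [W_succ (r + 1)]
    simp only [cos_zero, sin_zero] at h
    have hr : (0 : ℝ) ≤ r := by positivity
    have h5 : ((r : ℝ) + 2) * (((r : ℝ) + 2) ^ 2 - 1 / 16) * A (r + 2) 0 = (2 * r + 3) * 2 * A (r + 1) 0 := by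
      have : ((r : ℝ) + 1) ≠ 0 := by positivity
      apply mul_left_cancel₀ this
      linear_combination h
    have h6 : ((r : ℝ) + 2) * (W (r + 1) * (((r + 1 : ℕ) : ℝ) + 1) ^ 2 - W (r + 1) * (1 / 16)) * A (r + 1 + 1) 0
        = (2 * r + 3) * 2 * (W (r + 1) * A (r + 1) 0) := by
      push_cast
      linear_combination W (r + 1) * h5
    have h7 : ((r : ℝ) + 2) * (W (r + 1) * ((((r + 1 : ℕ) : ℝ) + 1) ^ 2 - 1 / 16) * A (r + 1 + 1) 0)
       ≤ ((r : ℝ) + 2) * 4 ^ (r + 1 + 1) := by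
      have e : (4 : ℝ) ^ (r + 1 + 1) = 4 * 4 ^ (r + 1) := by ring
      have hp : (0 : ℝ) < 4 ^ (r + 1) := by positivity
      rw [e]
      have : (2 * (r : ℝ) + 3) * 2 * (W (r + 1) * A (r + 1) 0) ≤ (2 * r + 3) * 2 * 4 ^ (r + 1) := by
        gcongr
      nlinarith
    exact le_of_mul_le_mul_left h7 (by positivity)

lemma WA_le (r : ℕ) (x : ℝ) : W r * A r x ≤ 4 ^ r := by
  refine le_trans ?_ (WA_zero_le r).1
  refine mul_le_mul_of_nonneg_left ?_ (W_pos r).le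
  unfold A
  refine sum_le_sum fun p _ => ?_
  refine mul_le_mul_of_nonneg_left ?_ (mul_pos (ec_pos _) (fc_pos _)).le
  simpa [ang] using cos_le_one _

/-- The bound of the remainder. -/
lemma R_bound (r : ℕ) : ∀ x : ℝ, 0 ≤ x → x ≤ 1 →
    (0 < x → 0 < (-1) ^ r * R r x) ∧ W r * ((-1) ^ r * R r x) ≤ x ^ (2 * r + 1) / 4 := by
  induction r with
  | zero =>
    intro x h0 h1
    have hpi := Real.pi_gt_three
    simp only [R_zero, W, U, V, pow_zero, one_mul, range_zero, prod_empty, mul_zero, zero_add, pow_one]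
    refine ⟨fun h => sin_pos_of_pos_of_lt_pi (by linarith) (by linarith), sin_le (by linarith)⟩
  | succ r ih =>
    have hpi := Real.pi_gt_three
    have hd : ∀ x, HasDerivAt (fun x => (-1) ^ (r + 1) * R (r + 1) x)
        (2 / ((r : ℝ) + 1) * sin x * ((-1) ^ r * R r x)) x := by
      intro x
      refine ((R_deriv r x).const_mul ((-1) ^ (r + 1))).congr_deriv ?_
      rw [pow_succ]; ring
    have hz : (-1) ^ (r + 1) * R (r + 1) 0 = 0 := by simp [R, ang]
    intro x h0 h1
    have hs : ∀ y ∈ Set.Ioo 0 x, 0 < sin y := fun y hy =>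
      sin_pos_of_pos_of_lt_pi hy.1 (by linarith [hy.2])
    constructor
    · intro hx
      have := strictMonoOn_of_deriv_pos (convex_Icc 0 x)
        (f := fun x => (-1) ^ (r + 1) * R (r + 1) x)
        (fun y _ => (hd y).continuousAt.continuousWithinAt) (by
          intro y hy
          rw [interior_Icc] at hy
          rw [(hd y).deriv]
          have h2 := (ih y hy.1.le (by linarith [hy.2])).1 hy.1
          have := hs y hy
          positivity)
      have h3 := this (Set.left_mem_Icc.mpr h0) (Set.right_mem_Icc.mpr h0) hx
      simp only [hz] at h3
      exact h3
    · have hd2 : ∀ y, HasDerivAt (fun y : ℝ => y ^ (2 * r + 3) / 4 - W (r + 1) * ((-1) ^ (r + 1) * R (r + 1) y))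
          ((2 * r + 3 : ℝ) * y ^ (2 * r + 2) / 4 - W (r + 1) * (2 / ((r : ℝ) + 1) * sin y * ((-1) ^ r * R r y))) y := by
        intro y
        refine HasDerivAt.sub ?_ ((hd y).const_mul _)
        have := (hasDerivAt_pow (2 * r + 3) y).div_const 4
        refine this.congr_deriv ?_
        rw [show 2 * r + 3 - 1 = 2 * r + 2 from rfl]; push_cast; ring
      have := monotoneOn_of_deriv_nonneg (convex_Icc 0 x)
        (f := fun y : ℝ => y ^ (2 * r + 3) / 4 - W (r + 1) * ((-1) ^ (r + 1) * R (r + 1) y))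
        (fun y _ => (hd2 y).continuousAt.continuousWithinAt)
        (fun y _ => (hd2 y).differentiableAt.differentiableWithinAt) (by
          intro y hy
          rw [interior_Icc] at hy
          rw [(hd2 y).deriv, W_succ]
          have hy1 : y ≤ 1 := by linarith [hy.2]
          have h2 := (ih y hy.1.le hy1).2
          have h3 := hs y hy
          have h4 : sin y ≤ y := sin_le hy.1.le
          have h5 := (ih y hy.1.le hy1).1 hy.1
          have h6 := W_pos r
          have hr : (0 : ℝ) ≤ r := by positivity
          generalize (-1) ^ r * R r y = Q at *
          have h7 : W r * Q * sin y ≤ y ^ (2 * r + 1) / 4 * y := by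
            have := hy.1
            gcongr
          have h8 : y ^ (2 * r + 1) / 4 * y = y ^ (2 * r + 2) / 4 := by ring
          have h9 : 0 ≤ y ^ (2 * r + 2) / 4 := by have := hy.1; positivity
          have h10 : W r * (((r : ℝ) + 1) ^ 2 - 1 / 16) * (2 / ((r : ℝ) + 1) * sin y * Q)
             = (((r : ℝ) + 1) ^ 2 - 1 / 16) * (2 / ((r : ℝ) + 1)) * (W r * Q * sin y) := by ring
          have h11 : (((r : ℝ) + 1) ^ 2 - 1 / 16) * (2 / ((r : ℝ) + 1)) ≤ 2 * r + 3 := by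
            rw [← mul_div_assoc, div_le_iff₀ (by positivity)]
            nlinarith
          have h12 : 0 ≤ W r * Q * sin y := by positivity
          rw [h10]
          have : (((r : ℝ) + 1) ^ 2 - 1 / 16) * (2 / ((r : ℝ) + 1)) * (W r * Q * sin y)
            ≤ (2 * r + 3) * (y ^ (2 * r + 2) / 4) := by
            rw [← h8]
            gcongr
          linarith)
      have h3 := this (Set.left_mem_Icc.mpr h0) (Set.right_mem_Icc.mpr h0) h0
      simp only [hz] at h3
      have e : 2 * (r + 1) + 1 = 2 * r + 3 := by ring
      rw [e]
      simp at h3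
      linarith
end Lj
namespace Lj
open Finset

lemma dvd_ap (k m s : ℕ) : (k.factorial : ℤ) ∣ 2 ^ k * ∏ j ∈ range k, (4 * ((m : ℤ) + j) + s) := by
  obtain ⟨e, o, ho, hk⟩ := Nat.exists_eq_two_pow_mul_odd (Nat.factorial_ne_zero k)
  have he : e ≤ k := by
    by_cases hk0 : k = 0
    · subst hk0
      by_contra hlt
      have : e ≠ 0 := by omega
      have h2 : 2 ∣ 2 ^ e * o := Dvd.dvd.mul_right (dvd_pow_self 2 this) o
      rw [← hk] at h2
      revert h2; decide
    · have h1 := Nat.emultiplicity_two_factorial_lt hk0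
      have h2 : (2 : ℕ) ^ e ∣ k.factorial := by rw [hk]; exact Dvd.intro _ rfl
      have h3 := le_emultiplicity_of_pow_dvd h2
      have h4 := lt_of_le_of_lt h3 h1
      exact_mod_cast h4.le
  have hcop : IsCoprime (o : ℤ) 4 := by
    have : Nat.Coprime o 4 := by
      have := Nat.Coprime.pow_right 2 (Nat.coprime_two_right.mpr ho)
      simpa using this
    exact_mod_cast Nat.isCoprime_iff_coprime.mpr this
  obtain ⟨u, v, huv⟩ := hcop
  -- natural number N with 4 N ≡ s mod o
  have hopos : 0 < o := ho.pos
  set N : ℕ := ((v * s) % (o : ℤ)).toNat with hN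
  have hN' : (N : ℤ) = (v * s) % (o : ℤ) := by
    rw [hN]; exact Int.toNat_of_nonneg (Int.emod_nonneg _ (by positivity))
  have hmod : (s : ℤ) ≡ 4 * N [ZMOD o] := by
    rw [hN']
    have h1 : 4 * ((v * s) % (o : ℤ)) ≡ 4 * (v * s) [ZMOD o] := (Int.mod_modEq _ _).mul_left 4
    refine Int.ModEq.trans ?_ h1.symm
    rw [Int.modEq_iff_dvd]
    refine ⟨-(u * s), ?_⟩
    linear_combination (s : ℤ) * huv
  have hprod : (∏ j ∈ range k, (4 * ((m : ℤ) + j) + s)) ≡ ∏ j ∈ range k, (4 * ((m : ℤ) + N + j)) [ZMOD o] := by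
    refine Int.ModEq.prod fun j _ => ?_
    have := hmod.add_left (4 * ((m : ℤ) + j))
    convert this using 1; ring
  have h5 : (k.factorial : ℤ) ∣ ∏ j ∈ range k, (4 * ((m : ℤ) + N + j)) := by
    rw [prod_mul_distrib]
    refine Dvd.dvd.mul_left ?_ _
    have := Nat.factorial_dvd_ascFactorial (m + N) k
    rw [Nat.ascFactorial_eq_prod_range] at this
    exact_mod_cast this
  have h6 : (o : ℤ) ∣ ∏ j ∈ range k, (4 * ((m : ℤ) + j) + s) := by
    refine hprod.dvd_iff.mpr (dvd_trans ?_ h5)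
    rw [hk]; push_cast; exact Dvd.intro_left _ rfl
  rw [hk]; push_cast
  exact mul_dvd_mul (pow_dvd_pow 2 he) h6
end Lj
namespace Lj
open Finset Real

lemma coef_int (k m : ℕ) : ∃ z : ℤ, (8 : ℝ) ^ (k + m) * W (k + m) * (ec k * fc m) = z := by
  obtain ⟨z1, h1⟩ := dvd_ap k m 5
  obtain ⟨z2, h2⟩ := dvd_ap m k 3
  refine ⟨z1 * z2, ?_⟩
  have hU : U (k + m) = U m * ∏ j ∈ range k, ((m : ℝ) + j + 1 + 1 / 4) := by
    unfold U; rw [add_comm k m, prod_range_add]; push_cast; rfl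
  have hV : V (k + m) = V k * ∏ j ∈ range m, ((k : ℝ) + j + 1 - 1 / 4) := by
    unfold V; rw [prod_range_add]; push_cast; rfl
  have e1 : (4 : ℝ) ^ k * ∏ j ∈ range k, ((m : ℝ) + j + 1 + 1 / 4)
      = ∏ j ∈ range k, (4 * ((m : ℝ) + j) + 5) := by
    rw [← card_range k, ← prod_const, card_range, ← prod_mul_distrib]
    exact prod_congr rfl fun j _ => by ring
  have e2 : (4 : ℝ) ^ m * ∏ j ∈ range m, ((k : ℝ) + j + 1 - 1 / 4)
      = ∏ j ∈ range m, (4 * ((k : ℝ) + j) + 3) := by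
    rw [← card_range m, ← prod_const, card_range, ← prod_mul_distrib]
    exact prod_congr rfl fun j _ => by ring
  have h1' : (2 : ℝ) ^ k * ∏ j ∈ range k, (4 * ((m : ℝ) + j) + 5) = k.factorial * z1 := by
    exact_mod_cast h1
  have h2' : (2 : ℝ) ^ m * ∏ j ∈ range m, (4 * ((k : ℝ) + j) + 3) = m.factorial * z2 := by
    exact_mod_cast h2
  rw [← e1] at h1'
  rw [← e2] at h2'
  unfold W ec fc
  rw [hU, hV]
  have hu := (U_pos m).ne'
  have hv := (V_pos k).ne'
  have hk : (k.factorial : ℝ) ≠ 0 := by positivity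
  have hm : (m.factorial : ℝ) ≠ 0 := by positivity
  have e8 : (8 : ℝ) ^ (k + m) = (2 ^ k * 4 ^ k) * (2 ^ m * 4 ^ m) := by
    rw [← mul_pow, ← mul_pow, ← pow_add]; norm_num
  rw [e8]
  generalize ∏ j ∈ range k, ((m : ℝ) + j + 1 + 1 / 4) = P at *
  generalize ∏ j ∈ range m, ((k : ℝ) + j + 1 - 1 / 4) = Q at *
  push_cast
  field_simp
  linear_combination (2 ^ m * (4 ^ m * Q)) * h1' + (k.factorial * z1 : ℝ) * h2'

/-- The base angle. -/
noncomputable def ph : ℝ := arctan (1 / 239)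

lemma arctan_le_self' {x : ℝ} (hx : 0 ≤ x) : arctan x ≤ x := by
  rcases hx.eq_or_lt with h | h
  · rw [← h, arctan_zero]
  · have h1 : 0 < arctan x := by simpa using h
    have h2 := (Real.lt_tan h1 (arctan_lt_pi_div_two x)).le
    rwa [tan_arctan] at h2

lemma ph_pos : 0 < ph := by unfold ph; simp
lemma ph_le : ph ≤ 1 / 239 := arctan_le_self' (by norm_num)

/-- Polar form. -/
lemma polar (T s : ℝ) (hT : 0 < T) :
    (T : ℂ) + s * Complex.I = (√(T ^ 2 + s ^ 2) : ℝ) * Complex.exp ((arctan (s / T) : ℝ) * Complex.I) := by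
  rw [Complex.exp_mul_I, ← Complex.ofReal_cos, ← Complex.ofReal_sin, cos_arctan, sin_arctan]
  have h : √(1 + (s / T) ^ 2) = √(T ^ 2 + s ^ 2) / T := by
    rw [show 1 + (s / T) ^ 2 = (T ^ 2 + s ^ 2) / T ^ 2 by field_simp,
      Real.sqrt_div (by positivity), Real.sqrt_sq hT.le]
  rw [h]
  have h2 : √(T ^ 2 + s ^ 2) ≠ 0 := by positivity
  generalize √(T ^ 2 + s ^ 2) = q at *
  have e1 : q * (1 / (q / T)) = T := by field_simp
  have e2 : q * (s / T / (q / T)) = s := by field_simp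
  rw [mul_add, ← mul_assoc, ← Complex.ofReal_mul, ← Complex.ofReal_mul, e1, e2]

lemma lin_form (g : GaussianInt) (G ps : ℝ)
    (hg : (g : ℂ) = (G : ℂ) * Complex.exp (((ps - ph) / 4 : ℝ) * Complex.I)) (r : ℕ) :
    ∃ n : ℤ, (n : ℝ) = G * 8 ^ r * √57122 ^ r * (W r * (R r ph * cos (ps / 4) - A r ph * sin (ps / 4))) := by
  choose C hC using coef_int
  let a : GaussianInt := ⟨239, 1⟩
  let z : GaussianInt := star g * ∑ p ∈ antidiagonal r, (C p.1 p.2 : GaussianInt) * a ^ p.2 * (star a) ^ p.1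
  refine ⟨z.im, ?_⟩
  have ha : (a : ℂ) = (√57122 : ℝ) * Complex.exp ((ph : ℝ) * Complex.I) := by
    have := polar 239 1 (by norm_num)
    norm_num at this
    rw [GaussianInt.toComplex_def']
    push_cast
    rw [one_mul, this]
    unfold ph; norm_num
  have hconj : ∀ y : ℝ, (starRingEnd ℂ) (Complex.exp ((y : ℂ) * Complex.I)) = Complex.exp (((-y : ℝ) : ℂ) * Complex.I) := by
    intro y
    rw [← Complex.exp_conj]
    simp
  have hz : (z : ℂ) = ∑ p ∈ antidiagonal r, ((G * 8 ^ r * √57122 ^ r * (W r * (ec p.1 * fc p.2)) : ℝ) : ℂ)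
      * Complex.exp (((ang p.1 p.2 ph - ps / 4 : ℝ) : ℂ) * Complex.I) := by
    simp only [z]
    rw [GaussianInt.toComplex_mul, map_sum, mul_sum]
    refine sum_congr rfl fun p hp => ?_
    have hr : p.1 + p.2 = r := mem_antidiagonal.mp hp
    rw [map_mul, map_mul, map_pow, map_pow, GaussianInt.toComplex_star, GaussianInt.toComplex_star, hg, ha,
      map_mul, map_mul, hconj, hconj, Complex.conj_ofReal, Complex.conj_ofReal, mul_pow, mul_pow,
      ← Complex.exp_nat_mul, ← Complex.exp_nat_mul, map_intCast]
    have hc : ((C p.1 p.2 : ℤ) : ℂ) = (((8 : ℝ) ^ r * W r * (ec p.1 * fc p.2) : ℝ) : ℂ) := by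
      rw [← hr, hC]; simp
    rw [hc]
    have hexp : Complex.exp (((ang p.1 p.2 ph - ps / 4 : ℝ) : ℂ) * Complex.I) =
       Complex.exp (((-((ps - ph) / 4) : ℝ) : ℂ) * Complex.I) * Complex.exp ((p.2 : ℂ) * ((ph : ℂ) * Complex.I))
        * Complex.exp ((p.1 : ℂ) * (((-ph : ℝ) : ℂ) * Complex.I)) := by
      rw [← Complex.exp_add, ← Complex.exp_add]
      congr 1
      unfold ang; push_cast; ring
    rw [hexp, ← hr]
    push_cast
    ring
  have h1 : ((z.im : ℤ) : ℝ) = (z : ℂ).im := GaussianInt.intCast_im z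
  rw [h1, hz, Complex.im_sum]
  unfold R A
  simp only [mul_sum, sum_mul, ← sum_sub_distrib]
  refine sum_congr rfl fun p _ => ?_
  rw [Complex.im_ofReal_mul, Complex.exp_ofReal_mul_I_im, sin_sub]
  ring

lemma choose_r (G : ℝ) (hG : 20000000000 ≤ G) (b : ℕ) (hb : b < 2) :
    ∃ j : ℕ, G < 478 * 29 ^ (6 + b + 2 * j) ∧ 338 * 7650 ^ (6 + b + 2 * j) < G ^ 3 := by
  have hex : ∃ j : ℕ, G < 478 * 29 ^ (6 + b + 2 * j) := by
    obtain ⟨n, hn⟩ := pow_unbounded_of_one_lt G (show (1 : ℝ) < 29 by norm_num)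
    refine ⟨n, hn.trans_le ?_⟩
    have : (29 : ℝ) ^ n ≤ 29 ^ (6 + b + 2 * n) := pow_le_pow_right₀ (by norm_num) (by omega)
    nlinarith [show (0 : ℝ) < 29 ^ n by positivity]
  classical
  refine ⟨Nat.find hex, Nat.find_spec hex, ?_⟩
  rcases hj : Nat.find hex with _ | j
  · have h1 : (7650 : ℝ) ^ (6 + b + 2 * 0) ≤ 7650 ^ 7 := pow_le_pow_right₀ (by norm_num) (by omega)
    have h2 : (20000000000 : ℝ) ^ 3 ≤ G ^ 3 := by gcongr
    have h3 : (338 : ℝ) * 7650 ^ 7 < 20000000000 ^ 3 := by norm_num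
    linarith
  · have h1 : ¬ G < 478 * 29 ^ (6 + b + 2 * j) := Nat.find_min hex (by omega)
    rw [not_lt] at h1
    have h2 : (478 * (29 : ℝ) ^ (6 + b + 2 * j)) ^ 3 ≤ G ^ 3 := by gcongr
    refine lt_of_lt_of_le ?_ h2
    have e1 : 6 + b + 2 * j = 6 + (b + 2 * j) := by ring
    have e2 : 6 + b + 2 * (j + 1) = 8 + (b + 2 * j) := by ring
    rw [e1, e2]
    generalize b + 2 * j = i
    rw [mul_pow, ← pow_mul, mul_comm (6 + i) 3, pow_mul, pow_add, pow_add]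
    have h3 : (7650 : ℝ) ^ i ≤ (29 ^ 3) ^ i := by gcongr; norm_num
    have h4 : (338 : ℝ) * 7650 ^ 8 < 478 ^ 3 * (29 ^ 3) ^ 6 := by norm_num
    have h5 : (0 : ℝ) < 7650 ^ i := by positivity
    calc (338 : ℝ) * (7650 ^ 8 * 7650 ^ i) = (338 * 7650 ^ 8) * 7650 ^ i := by ring
      _ < (478 ^ 3 * (29 ^ 3) ^ 6) * 7650 ^ i := by gcongr
      _ ≤ (478 ^ 3 * (29 ^ 3) ^ 6) * (29 ^ 3) ^ i := by gcongr
      _ = _ := by ring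

lemma main_contra (g : GaussianInt) (G ps : ℝ) (hG : 20000000000 ≤ G) (h0 : ps ≠ 0)
    (hps : |ps| ≤ 676 / G ^ 4)
    (hg : (g : ℂ) = (G : ℂ) * Complex.exp (((ps - ph) / 4 : ℝ) * Complex.I)) : False := by
  obtain ⟨b, hb2, hb⟩ : ∃ b : ℕ, b < 2 ∧ ((0 < ps ∧ b = 1) ∨ (ps < 0 ∧ b = 0)) := by
    rcases lt_or_gt_of_ne h0 with h | h
    · exact ⟨0, by norm_num, Or.inr ⟨h, rfl⟩⟩
    · exact ⟨1, by norm_num, Or.inl ⟨h, rfl⟩⟩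
  obtain ⟨j, hj1, hj2⟩ := choose_r G hG b hb2
  have hsgn : (-1 : ℝ) ^ (6 + b + 2 * j) = (-1) ^ b := by
    rw [show 6 + b + 2 * j = b + 2 * (3 + j) by ring, pow_add, pow_mul]; simp
  generalize 6 + b + 2 * j = r at *
  obtain ⟨n, hn⟩ := lin_form g G ps hg r
  have hG0 : 0 < G := by linarith
  have hsmall : |ps| ≤ 1 := by
    refine hps.trans ?_
    rw [div_le_one (by positivity)]
    have : (20000000000 : ℝ) ^ 4 ≤ G ^ 4 := by gcongr
    norm_num at this ⊢
    linarith
  have hpi := Real.pi_gt_three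
  have hp1 : ph ≤ 1 := ph_le.trans (by norm_num)
  obtain ⟨hR1, hR2⟩ := R_bound r ph ph_pos.le hp1
  have hR1 := hR1 ph_pos
  have hA1 := (A_pos ph ph_pos.le hp1 r).1
  have hA2 := WA_le r ph
  have hW := W_pos r
  rw [hsgn] at hR1 hR2
  obtain ⟨hps1, hps2⟩ := abs_le.mp hsmall
  have hcos : 0 < cos (ps / 4) := cos_pos_of_mem_Ioo ⟨by linarith, by linarith⟩
  have hne : R r ph * cos (ps / 4) - A r ph * sin (ps / 4) ≠ 0 := by
    rcases hb with ⟨h, rfl⟩ | ⟨h, rfl⟩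
    · have hs : 0 < sin (ps / 4) := sin_pos_of_pos_of_lt_pi (by linarith) (by linarith)
      have hR : R r ph < 0 := by linarith
      have := mul_pos hA1 hs
      have := mul_neg_of_neg_of_pos hR hcos
      linarith
    · have hs : sin (ps / 4) < 0 := sin_neg_of_neg_of_neg_pi_lt (by linarith) (by linarith)
      have hR : 0 < R r ph := by linarith
      have := mul_neg_of_pos_of_neg hA1 hs
      have := mul_pos hR hcos
      linarith
  have hn0 : n ≠ 0 := by
    intro h
    rw [h, Int.cast_zero] at hn
    have : G * 8 ^ r * √57122 ^ r * W r ≠ 0 := by positivity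
    rw [← mul_assoc] at hn
    exact mul_ne_zero this hne hn.symm
  have h1 : (1 : ℝ) ≤ |(n : ℝ)| := by exact_mod_cast Int.one_le_abs hn0
  have hRabs : W r * |R r ph| ≤ ph ^ (2 * r + 1) / 4 := by
    have : |R r ph| = (-1) ^ b * R r ph := by
      rw [← abs_of_pos hR1, abs_mul, abs_pow]; simp
    rw [this]; exact hR2
  have hsin : |sin (ps / 4)| ≤ 169 / G ^ 4 := by
    have := Real.abs_sin_le_abs (x := ps / 4)
    rw [abs_div, abs_of_pos (show (0 : ℝ) < 4 by norm_num)] at this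
    have e : 169 / G ^ 4 = 676 / G ^ 4 / 4 := by ring
    rw [e]; linarith
  have hE : |W r * (R r ph * cos (ps / 4) - A r ph * sin (ps / 4))|
      ≤ ph ^ (2 * r + 1) / 4 + 4 ^ r * (169 / G ^ 4) := by
    rw [abs_mul, abs_of_pos hW]
    have t1 : |R r ph * cos (ps / 4) - A r ph * sin (ps / 4)| ≤ |R r ph| * 1 + A r ph * |sin (ps / 4)| := by
      refine (abs_sub _ _).trans ?_
      rw [abs_mul, abs_mul, abs_of_pos hA1]
      have := abs_cos_le_one (ps / 4)
      gcongr
    calc _ ≤ W r * (|R r ph| * 1 + A r ph * |sin (ps / 4)|) := by gcongr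
      _ = W r * |R r ph| + (W r * A r ph) * |sin (ps / 4)| := by ring
      _ ≤ _ := by gcongr
  have hq : √57122 ≤ 23901 / 100 := by
    rw [Real.sqrt_le_left (by norm_num)]; norm_num
  have hq0 : 0 < √57122 := by positivity
  have hb1 : 8 ^ r * √57122 ^ r * (ph ^ (2 * r + 1) / 4) ≤ (1 / 29) ^ r * (1 / 956) := by
    have e : 8 ^ r * √57122 ^ r * (ph ^ (2 * r + 1) / 4) = (8 * √57122 * ph ^ 2) ^ r * (ph / 4) := by
      rw [mul_pow, mul_pow]; ring
    rw [e]
    have h2 := ph_le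
    have h3 := ph_pos
    have : 8 * √57122 * ph ^ 2 ≤ 1 / 29 := by
      calc 8 * √57122 * ph ^ 2 ≤ 8 * (23901 / 100) * (1 / 239) ^ 2 := by gcongr
        _ ≤ _ := by norm_num
    have h4 : ph / 4 ≤ 1 / 956 := by linarith
    gcongr
  have hb2 : 8 ^ r * √57122 ^ r * (4 ^ r * (169 / G ^ 4)) ≤ 7650 ^ r * (169 / G ^ 4) := by
    have e : 8 ^ r * √57122 ^ r * (4 ^ r * (169 / G ^ 4)) = (8 * √57122 * 4) ^ r * (169 / G ^ 4) := by
      rw [mul_pow, mul_pow]; ring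
    rw [e]
    have : 8 * √57122 * 4 ≤ 7650 := by linarith
    gcongr
  have hfin : |(n : ℝ)| ≤ G * ((1 / 29) ^ r * (1 / 956)) + G * (7650 ^ r * (169 / G ^ 4)) := by
    rw [hn, abs_mul, abs_of_pos (show 0 < G * 8 ^ r * √57122 ^ r by positivity)]
    calc _ ≤ G * 8 ^ r * √57122 ^ r * (ph ^ (2 * r + 1) / 4 + 4 ^ r * (169 / G ^ 4)) := by gcongr
      _ = G * (8 ^ r * √57122 ^ r * (ph ^ (2 * r + 1) / 4)) + G * (8 ^ r * √57122 ^ r * (4 ^ r * (169 / G ^ 4))) := by ring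
      _ ≤ _ := by gcongr
  have hc1 : G * ((1 / 29) ^ r * (1 / 956)) < 1 / 2 := by
    rw [one_div_pow]
    have : (0 : ℝ) < 29 ^ r := by positivity
    calc G * (1 / 29 ^ r * (1 / 956)) < (478 * 29 ^ r) * (1 / 29 ^ r * (1 / 956)) := by gcongr
      _ = 1 / 2 := by field_simp; norm_num
  have hc2 : G * (7650 ^ r * (169 / G ^ 4)) < 1 / 2 := by
    have e : G * (7650 ^ r * (169 / G ^ 4)) = (7650 ^ r * 169) / G ^ 3 := by field_simp
    rw [e, div_lt_iff₀ (by positivity)]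
    linarith
  linarith
end Lj
namespace Lj

lemma thue (p t : ℤ) (hp : 0 < p) (h : 2 * p ^ 4 - 1 = t ^ 2) :
    ∃ (b : GaussianInt) (s : ℤ), (s = 1 ∨ s = -1) ∧ b.norm = p ∧
      (⟨-1, 1⟩ : GaussianInt) * b ^ 4 = ⟨s * t, 1⟩ := by
  have hodd : Odd t := by
    have : Odd (t ^ 2) := by rw [← h]; exact ⟨p ^ 4 - 1, by ring⟩
    exact (Int.odd_pow' (by norm_num)).mp this
  obtain ⟨s, rfl⟩ := hodd
  have hp4 : p ^ 4 = 2 * (s * (s + 1)) + 1 := by linarith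
  have hpodd : Odd p := by
    have : Odd (p ^ 4) := ⟨_, hp4⟩
    exact (Int.odd_pow' (by norm_num)).mp this
  let d : GaussianInt := ⟨s + 1, -s⟩
  have hmul : d * star d = (p : GaussianInt) ^ 4 := by
    rw [← Int.cast_pow, hp4]
    ext <;> simp [d] <;> ring
  have hcop : IsCoprime d (star d) := by
    refine ⟨star d - ((s * (s + 1) : ℤ) : GaussianInt) * ⟨1, -1⟩, - ((s * (s + 1) : ℤ) : GaussianInt) * ⟨1, 1⟩, ?_⟩
    ext <;> simp [d] <;> ring
  obtain ⟨c, u, hu⟩ := exists_associated_pow_of_mul_eq_pow' hcop hmul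
  have hun : (u : GaussianInt).norm = 1 := by
    have := (Zsqrtd.norm_eq_one_iff' (by norm_num) (u : GaussianInt)).mpr u.isUnit
    exact this
  have hdn : d.norm = p ^ 4 := by
    rw [hp4]; simp [d, Zsqrtd.norm_def]; ring
  have hcn : c.norm = p := by
    have h1 : (c ^ 4 * (u : GaussianInt)).norm = p ^ 4 := by rw [hu, hdn]
    rw [Zsqrtd.norm_mul, hun, mul_one] at h1
    have h2 : c.norm ^ 4 = p ^ 4 := by
      rw [← h1]; exact (map_pow Zsqrtd.normMonoidHom c 4).symm
    exact (pow_left_inj₀ (GaussianInt.norm_nonneg c) hp.le (by norm_num)).mp h2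
  obtain ⟨x, y⟩ := c
  have hxy : x ^ 2 + y ^ 2 = p := by
    rw [← hcn]; simp [Zsqrtd.norm_def]; ring
  have hX : (⟨x, y⟩ : GaussianInt) ^ 4 = ⟨x ^ 4 - 6 * x ^ 2 * y ^ 2 + y ^ 4, 4 * (x ^ 3 * y - x * y ^ 3)⟩ := by
    rw [show (⟨x, y⟩ : GaussianInt) ^ 4 = ⟨x, y⟩ * ⟨x, y⟩ * (⟨x, y⟩ * ⟨x, y⟩) by ring]
    ext <;> simp <;> ring
  have hX' : (⟨x, -y⟩ : GaussianInt) ^ 4 = ⟨x ^ 4 - 6 * x ^ 2 * y ^ 2 + y ^ 4, -(4 * (x ^ 3 * y - x * y ^ 3))⟩ := by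
    rw [show (⟨x, -y⟩ : GaussianInt) ^ 4 = ⟨x, -y⟩ * ⟨x, -y⟩ * (⟨x, -y⟩ * ⟨x, -y⟩) by ring]
    ext <;> simp <;> ring
  have hX4 : ∃ q, x ^ 4 - 6 * x ^ 2 * y ^ 2 + y ^ 4 = 4 * q + 1 := by
    obtain ⟨w, hw⟩ := hpodd
    refine ⟨w ^ 2 + w - 2 * x ^ 2 * y ^ 2, ?_⟩
    have : (x ^ 2 + y ^ 2) ^ 2 = (2 * w + 1) ^ 2 := by rw [hxy, hw]
    linear_combination this
  obtain ⟨q, hq⟩ := hX4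
  rw [hX, hq] at hu
  rw [hq] at hX hX'
  generalize x ^ 3 * y - x * y ^ 3 = Y at *
  obtain ⟨⟨u1, u2⟩, _, _, _⟩ := u
  simp only [Zsqrtd.norm_def] at hun
  have e1 := congrArg Zsqrtd.re hu
  have e2 := congrArg Zsqrtd.im hu
  simp [d] at e1 e2
  have hu12 : (u1 = 1 ∧ u2 = 0) ∨ (u1 = -1 ∧ u2 = 0) ∨ (u1 = 0 ∧ u2 = 1) ∨ (u1 = 0 ∧ u2 = -1) := by
    have a1 : u1 ≤ 1 := by nlinarith [mul_self_nonneg u1, mul_self_nonneg u2]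
    have a2 : -1 ≤ u1 := by nlinarith [mul_self_nonneg u1, mul_self_nonneg u2]
    have a3 : u2 ≤ 1 := by nlinarith [mul_self_nonneg u1, mul_self_nonneg u2]
    have a4 : -1 ≤ u2 := by nlinarith [mul_self_nonneg u1, mul_self_nonneg u2]
    interval_cases u1 <;> interval_cases u2 <;> simp_all
  rcases hu12 with ⟨rfl, rfl⟩ | ⟨rfl, rfl⟩ | ⟨rfl, rfl⟩ | ⟨rfl, rfl⟩
  · refine ⟨⟨x, -y⟩, -1, Or.inr rfl, ?_, ?_⟩
    · rw [← hxy]; simp [Zsqrtd.norm_def]; ring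
    · rw [hX']
      ext <;> simp <;> omega
  · exfalso; omega
  · refine ⟨⟨x, y⟩, 1, Or.inl rfl, ?_, ?_⟩
    · rw [← hxy]; simp [Zsqrtd.norm_def]; ring
    · rw [hX]
      ext <;> simp <;> omega
  · exfalso; omega

/-- The Pell sequence. -/
def pell : ℕ → ℕ × ℕ
  | 0 => (1, 1)
  | n + 1 => (3 * (pell n).1 + 4 * (pell n).2, 2 * (pell n).1 + 3 * (pell n).2)

lemma pell_complete (w : ℕ) : ∀ t : ℕ, 0 < w → t ^ 2 + 1 = 2 * w ^ 2 → ∃ n, pell n = (t, w) := by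
  induction w using Nat.strong_induction_on with
  | _ w ih =>
    intro t hw h
    by_cases h1 : w = 1
    · subst h1
      have : t = 1 := by nlinarith
      exact ⟨0, by rw [this]; rfl⟩
    · have hw2 : 2 ≤ w := by omega
      have a1 : 2 * t < 3 * w := by nlinarith
      have a2 : w < t := by nlinarith
      have a3 : 4 * w ≤ 3 * t := by
        by_contra hc
        have hw' : 9 * (t ^ 2 + 1) = 18 * w ^ 2 := by omega
        have : (3 * t + 1) ^ 2 ≤ (4 * w) ^ 2 := Nat.pow_le_pow_left (by omega) 2
        nlinarith
      obtain ⟨n, hn⟩ := ih (3 * w - 2 * t) (by omega) (3 * t - 4 * w) (by omega) (by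
        zify [a1.le, a3]
        have : (t : ℤ) ^ 2 + 1 = 2 * w ^ 2 := by exact_mod_cast h
        linear_combination this)
      refine ⟨n + 1, ?_⟩
      rw [pell, hn]
      simp only [Prod.mk.injEq]
      omega

lemma pell_growth (n : ℕ) : 5 ^ n ≤ (pell n).2 ∧ (pell n).2 ≤ (pell n).1 := by
  induction n with
  | zero => simp [pell]
  | succ n ih => simp only [pell, pow_succ]; omega

set_option maxRecDepth 10000 in
lemma small (p t : ℕ) (hp : 0 < p) (hlt : p < 10 ^ 20) (h : t ^ 2 + 1 = 2 * p ^ 4) : p = 1 ∨ p = 13 := by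
  obtain ⟨n, hn⟩ := pell_complete (p ^ 2) t (by positivity) (by rw [h]; ring)
  have h1 := (pell_growth n).1
  rw [hn] at h1
  simp only at h1
  have h2 : p ^ 2 < (10 ^ 20) ^ 2 := Nat.pow_lt_pow_left hlt (by norm_num)
  have h3 : n < 58 := by
    by_contra hc
    have : 5 ^ 58 ≤ 5 ^ n := Nat.pow_le_pow_right (by norm_num) (by omega)
    have : (10 ^ 20) ^ 2 < 5 ^ 58 := by norm_num
    omega
  have hs : IsSquare (pell n).2 := ⟨p, by rw [hn, sq]⟩
  by_cases n0 : n = 0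
  · subst n0
    have : p ^ 2 = 1 := by simpa [pell] using (congrArg Prod.snd hn).symm
    left; nlinarith
  by_cases n3 : n = 3
  · subst n3
    have : p ^ 2 = 169 := by simpa [pell] using (congrArg Prod.snd hn).symm
    right; nlinarith
  clear hn h1
  interval_cases n <;> first | contradiction | (norm_num [pell] at hs)
end Lj
namespace Lj
open Real

lemma fourth_root (h : ℂ) (c : ℝ) (hh : h ^ 4 = (c : ℂ) ^ 4) :
    ∃ u : GaussianInt, u.norm = 1 ∧ (u : ℂ) * h = c := by
  have hI := Complex.I_sq
  have : (h - c) * ((h + c) * ((h - c * Complex.I) * (h + c * Complex.I))) = 0 := by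
    linear_combination hh + (c : ℂ) ^ 2 * (c ^ 2 - h ^ 2) * hI
  rcases mul_eq_zero.mp this with h1 | h1
  · exact ⟨1, by simp, by rw [GaussianInt.toComplex_one]; linear_combination h1⟩
  rcases mul_eq_zero.mp h1 with h1 | h1
  · exact ⟨-1, by simp, by
      rw [GaussianInt.toComplex_neg, GaussianInt.toComplex_one]; linear_combination -h1⟩
  rcases mul_eq_zero.mp h1 with h1 | h1
  · refine ⟨⟨0, -1⟩, by simp [Zsqrtd.norm_def], ?_⟩
    rw [GaussianInt.toComplex_def']; push_cast
    linear_combination -Complex.I * h1 - (c : ℂ) * hI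
  · refine ⟨⟨0, 1⟩, by simp [Zsqrtd.norm_def], ?_⟩
    rw [GaussianInt.toComplex_def']; push_cast
    linear_combination Complex.I * h1 - (c : ℂ) * hI

lemma norm_sq_gauss (g : GaussianInt) : ‖(g : ℂ)‖ ^ 2 = (g.norm : ℝ) := by
  rw [← Complex.normSq_eq_norm_sq, GaussianInt.intCast_real_norm]

lemma rotate (g : GaussianInt) (l T s : ℝ) (hl : 0 < l) (hT : 0 < T)
    (hg : (g : ℂ) ^ 4 = l * ((T : ℂ) + s * Complex.I) * (239 - Complex.I)) :
    ∃ g' : GaussianInt, (g' : ℂ) =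
      ((‖(g : ℂ)‖ : ℝ) : ℂ) * Complex.exp (((arctan (s / T) - ph) / 4 : ℝ) * Complex.I) := by
  have h1 := polar T s hT
  have h2 : (239 : ℂ) - Complex.I = (√57122 : ℝ) * Complex.exp (((-ph : ℝ) : ℂ) * Complex.I) := by
    have := polar 239 (-1) (by norm_num)
    rw [neg_div, arctan_neg] at this
    norm_num at this
    unfold ph
    rw [sub_eq_add_neg, this]; norm_num
  set m : ℝ := l * √(T ^ 2 + s ^ 2) * √57122 with hm
  have hm0 : 0 < m := by positivity
  set E := Complex.exp (((-((arctan (s / T) - ph) / 4) : ℝ) : ℂ) * Complex.I) with hE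
  have hE4 : E ^ 4 = Complex.exp (((-(arctan (s / T) - ph) : ℝ) : ℂ) * Complex.I) := by
    rw [hE, ← Complex.exp_nat_mul]; congr 1; push_cast; ring
  have h4 : ((g : ℂ) * E) ^ 4 = m := by
    rw [mul_pow, hg, h1, h2, hE4, hm]
    have e : Complex.exp ((arctan (s / T) : ℝ) * Complex.I) * Complex.exp (((-ph : ℝ) : ℂ) * Complex.I)
       * Complex.exp (((-(arctan (s / T) - ph) : ℝ) : ℂ) * Complex.I) = 1 := by
      rw [← Complex.exp_add, ← Complex.exp_add, ← Complex.exp_zero]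
      congr 1; push_cast; ring
    push_cast at e ⊢
    linear_combination ((l : ℂ) * (√(T ^ 2 + s ^ 2) : ℝ) * (√57122 : ℝ)) * e
  have hEn : ‖E‖ = 1 := Complex.norm_exp_ofReal_mul_I _
  have h5 : ‖(g : ℂ)‖ ^ 4 = m := by
    have := congrArg norm h4
    rw [norm_pow, norm_mul, hEn, mul_one, Complex.norm_real, Real.norm_of_nonneg hm0.le] at this
    exact this
  obtain ⟨u, hu1, hu2⟩ := fourth_root ((g : ℂ) * E) ‖(g : ℂ)‖ (by rw [h4, ← h5]; push_cast; rfl)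
  refine ⟨u * g, ?_⟩
  rw [GaussianInt.toComplex_mul, ← hu2]
  have e : E * Complex.exp (((arctan (s / T) - ph) / 4 : ℝ) * Complex.I) = 1 := by
    rw [hE, ← Complex.exp_add, ← Complex.exp_zero]
    congr 1; push_cast; ring
  linear_combination -((u : ℂ) * g) * e

lemma large (p t : ℤ) (hp : 10 ^ 20 ≤ p) (ht : 0 < t) (h : 2 * p ^ 4 - 1 = t ^ 2) : False := by
  have hp0 : 0 < p := by linarith
  obtain ⟨b, s, hs, hbn, hb⟩ := thue p t hp0 h
  -- T ≥ p ^ 2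
  have htp : p ^ 2 ≤ t := by
    have : (p ^ 2) ^ 2 ≤ t ^ 2 := by
      have : 1 ≤ p ^ 4 := by have := pow_pos hp0 4; omega
      rw [← h]; ring_nf; linarith
    exact (sq_le_sq₀ (by positivity) ht.le).mp this
  have htR : (p : ℝ) ^ 2 ≤ t := by exact_mod_cast htp
  have htR0 : (0 : ℝ) < t := by exact_mod_cast ht
  have hpR : (10 : ℝ) ^ 20 ≤ p := by exact_mod_cast hp
  have hpR0 : (0 : ℝ) < p := by exact_mod_cast hp0
  have hbC : (-1 + Complex.I) * (b : ℂ) ^ 4 = s * t + Complex.I := by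
    have := congrArg GaussianInt.toComplex hb
    rw [map_mul, map_pow, GaussianInt.toComplex_def' (-1) 1, GaussianInt.toComplex_def' (s * t) 1] at this
    push_cast at this
    linear_combination this
  have hI := Complex.I_sq
  -- the Gaussian integer and the sign
  obtain ⟨g, l, hl, hgn1, hgn2, hg⟩ : ∃ (g : GaussianInt) (l : ℝ), 0 < l ∧ 13 * p ≤ g.norm ∧ g.norm ≤ 26 * p ∧
      (g : ℂ) ^ 4 = l * (((t : ℝ) : ℂ) + ((s : ℝ) : ℂ) * Complex.I) * (239 - Complex.I) := by
    have hI3 : Complex.I ^ 3 = -Complex.I := by rw [pow_succ, hI]; ring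
    have hI4 : Complex.I ^ 4 = 1 := by rw [show (4 : ℕ) = 2 * 2 by norm_num, pow_mul, hI]; norm_num
    have hα : ((2 : ℂ) - 3 * Complex.I) ^ 4 = -119 + 120 * Complex.I := by
      linear_combination 216 * hI - 216 * hI3 + 81 * hI4
    have hα2 : (-1 + Complex.I) * ((239 : ℂ) - Complex.I) * 1 = -238 + 240 * Complex.I := by
      linear_combination -hI
    have hγ : ((b : ℂ) * (2 - 3 * Complex.I)) ^ 4 = 1 / 2 * (s * t + Complex.I) * (239 - Complex.I) := by
      rw [mul_pow, hα, ← hbC]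
      linear_combination (-(b : ℂ) ^ 4 / 2) * hα2
    rcases hs with rfl | rfl
    · refine ⟨b * ⟨2, -3⟩, 1 / 2, by norm_num, ?_, ?_, ?_⟩
      · rw [Zsqrtd.norm_mul, hbn]; simp [Zsqrtd.norm_def]; linarith
      · rw [Zsqrtd.norm_mul, hbn]; simp [Zsqrtd.norm_def]; linarith
      · rw [GaussianInt.toComplex_mul, GaussianInt.toComplex_def' 2 (-3)]
        push_cast at hγ ⊢
        rw [show (2 : ℂ) + -3 * Complex.I = 2 - 3 * Complex.I by ring, hγ]
        ring
    · refine ⟨b * ⟨2, -3⟩ * ⟨1, 1⟩, 2, by norm_num, ?_, ?_, ?_⟩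
      · rw [Zsqrtd.norm_mul, Zsqrtd.norm_mul, hbn]; simp [Zsqrtd.norm_def]; linarith
      · rw [Zsqrtd.norm_mul, Zsqrtd.norm_mul, hbn]; simp [Zsqrtd.norm_def]; linarith
      · rw [GaussianInt.toComplex_mul, GaussianInt.toComplex_mul, GaussianInt.toComplex_def' 2 (-3),
          GaussianInt.toComplex_def' 1 1]
        push_cast at hγ ⊢
        rw [show (2 : ℂ) + -3 * Complex.I = 2 - 3 * Complex.I by ring, mul_pow, hγ]
        have : (1 + 1 * Complex.I) ^ 4 = -4 := by
          linear_combination 6 * hI + 4 * hI3 + hI4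
        rw [this]; ring
  obtain ⟨g', hg'⟩ := rotate g l t s hl htR0 hg
  have hns := norm_sq_gauss g
  have hn1 : (13 : ℝ) * p ≤ (g.norm : ℝ) := by exact_mod_cast hgn1
  have hn2 : (g.norm : ℝ) ≤ 26 * p := by exact_mod_cast hgn2
  have hG0 := norm_nonneg (g : ℂ)
  generalize ‖(g : ℂ)‖ = G at *
  have hGbig : 20000000000 ≤ G := by
    by_contra hc
    rw [not_le] at hc
    have : G ^ 2 < 20000000000 ^ 2 := by gcongr
    norm_num at this hpR
    linarith
  have hGpos : 0 < G := by linarith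
  have hG4 : G ^ 4 ≤ 676 * p ^ 2 := by
    have : (G ^ 2) ^ 2 ≤ (26 * (p : ℝ)) ^ 2 := by
      rw [hns]
      have : (0 : ℝ) ≤ g.norm := by linarith
      gcongr
    nlinarith
  refine main_contra g' G (arctan ((s : ℝ) / t)) hGbig ?_ ?_ hg'
  · rw [Ne, arctan_eq_zero_iff]
    have : (s : ℝ) ≠ 0 := by rcases hs with rfl | rfl <;> norm_num
    positivity
  · have h1 : |arctan ((s : ℝ) / t)| ≤ 1 / t := by
      have h0 := arctan_le_self' (x := 1 / (t : ℝ)) (by positivity)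
      have h00 : 0 ≤ arctan (1 / (t : ℝ)) := by rw [arctan_nonneg]; positivity
      rcases hs with rfl | rfl
      · push_cast; rwa [abs_of_nonneg h00]
      · push_cast; rwa [neg_div, arctan_neg, abs_neg, abs_of_nonneg h00]
    refine h1.trans ?_
    rw [div_le_div_iff₀ htR0 (by positivity)]
    nlinarith
end Lj

/-- Ljunggren's theorem: the only positive integer solutions of `2p^4 - 1 = t^2`
have `p = 1` or `p = 13`. -/
theorem stmt10 (p t : ℤ) (hp : 0 < p) (ht : 0 < t) (h : 2 * p ^ 4 - 1 = t ^ 2) :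
    p = 1 ∨ p = 13 := by
  by_cases hc : 10 ^ 20 ≤ p
  · exact (Lj.large p t hc ht h).elim
  · lift p to ℕ using hp.le
    lift t to ℕ using ht.le
    have := Lj.small p t (by exact_mod_cast hp) (by exact_mod_cast not_le.mp hc) (by
      zify; linarith)
    exact_mod_cast this
end
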